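/- arXiv:2309.02704 — 5 statements merged into one kernel-verified Lean document; each statement's English description precedes it below -/
import Mathlib

section
/- Let G be a finite simple graph on n ≥ 1 vertices with Laplacian matrix L, and let a > 0 be a real number. Then L + a·I_n is invertible, and the matrices M = L + a·I_n − (a/n)·J_n and X = (L + a·I_n)⁻¹ − (1/(a·n))·J_n satisfy the group-inverse equations M·X·M = M, X·M·X = X, and M·X = X·M (that is, X is the group inverse of M). -/
open Matrix

-- The Laplacian matrix `L = D − A` of a finite simple graph, over `ℝ`.
open Classical in
noncomputable def lapMat {V : Type} [Fintype V] (G : SimpleGraph V) : Matrix V V ℝ :=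
  Matrix.of fun i j =>
    if i = j then (Nat.card {v // G.Adj i v} : ℝ)
    else if G.Adj i j then -1 else 0

/-- The `n × n` all-ones matrix over `ℝ`. -/
def allOnes (n : ℕ) : Matrix (Fin n) (Fin n) ℝ := Matrix.of fun _ _ => 1

theorem lapMat_eq_lapMatrix {V : Type} [Fintype V] [DecidableEq V] (G : SimpleGraph V)
    [DecidableRel G.Adj] :
    lapMat G = G.lapMatrix ℝ := by
  ext i j
  by_cases h : i = j
  · subst h
    simp [lapMat, SimpleGraph.lapMatrix, SimpleGraph.degMatrix, SimpleGraph.adjMatrix_apply,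
      ← SimpleGraph.card_neighborSet_eq_degree, Nat.card_eq_fintype_card,
      Fintype.card_subtype]
  · by_cases hij : G.Adj i j <;>
      simp [lapMat, SimpleGraph.lapMatrix, SimpleGraph.degMatrix, SimpleGraph.adjMatrix_apply,
        h, hij]

theorem lapMat_transpose {V : Type} [Fintype V] (G : SimpleGraph V) :
    (lapMat G)ᵀ = lapMat G := by
  classical
  rw [lapMat_eq_lapMatrix]
  exact G.isSymm_lapMatrix ℝ

theorem allOnes_transpose (n : ℕ) : (allOnes n)ᵀ = allOnes n := rfl

theorem lapMat_mul_allOnes {n : ℕ} (G : SimpleGraph (Fin n)) : lapMat G * allOnes n = 0 := by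
  classical
  ext i j
  have h := congrFun (G.lapMatrix_mulVec_const_eq_zero (R := ℝ)) i
  rw [← lapMat_eq_lapMatrix] at h
  simpa [Matrix.mul_apply, Matrix.mulVec, dotProduct, allOnes] using h

theorem allOnes_mul_lapMat {n : ℕ} (G : SimpleGraph (Fin n)) : allOnes n * lapMat G = 0 := by
  rw [← Matrix.transpose_inj, Matrix.transpose_mul, lapMat_transpose, allOnes_transpose,
    lapMat_mul_allOnes, Matrix.transpose_zero]

theorem allOnes_mul_allOnes (n : ℕ) : allOnes n * allOnes n = (n : ℝ) • allOnes n := by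
  ext i j
  simp [Matrix.mul_apply, allOnes]

theorem isUnit_lapMat_add_smul_one {V : Type} [Fintype V] [DecidableEq V] (G : SimpleGraph V)
    {a : ℝ} (ha : 0 < a) : IsUnit (lapMat G + a • (1 : Matrix V V ℝ)) := by
  classical
  have hL : (lapMat G).PosSemidef := by
    rw [lapMat_eq_lapMatrix]
    exact G.posSemidef_lapMatrix ℝ
  exact (Matrix.PosDef.posSemidef_add hL (Matrix.PosDef.one.smul ha)).isUnit

/-- If `B` is a two-sided inverse of `A` and `P` is an idempotent with `A * P = P * A = a • P`,
then `B - a⁻¹ • P` is the group inverse of `A - a • P`. -/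
theorem groupInverse_sub_smul_idempotent {K R : Type*} [Field K] [Ring R] [Algebra K R]
    {A B P : R} {a : K} (ha : a ≠ 0) (hAB : A * B = 1) (hBA : B * A = 1)
    (hAP : A * P = a • P) (hPA : P * A = a • P) (hP : P * P = P) :
    (A - a • P) * (B - a⁻¹ • P) * (A - a • P) = A - a • P ∧
    (B - a⁻¹ • P) * (A - a • P) * (B - a⁻¹ • P) = B - a⁻¹ • P ∧
    (A - a • P) * (B - a⁻¹ • P) = (B - a⁻¹ • P) * (A - a • P) := by
  have hBP : B * P = a⁻¹ • P := by
    have h : a • (B * P) = P := by rw [← mul_smul_comm, ← hAP, ← mul_assoc, hBA, one_mul]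
    rw [← h, smul_smul, inv_mul_cancel₀ ha, one_smul, h]
  have hPB : P * B = a⁻¹ • P := by
    have h : a • (P * B) = P := by rw [← smul_mul_assoc, ← hPA, mul_assoc, hAB, mul_one]
    rw [← h, smul_smul, inv_mul_cancel₀ ha, one_smul, h]
  have hMX : (A - a • P) * (B - a⁻¹ • P) = 1 - P := by
    simp [sub_mul, mul_sub, hAB, hAP, hPB, hP, smul_smul, ha]
  have hXM : (B - a⁻¹ • P) * (A - a • P) = 1 - P := by
    simp [sub_mul, mul_sub, hBA, hBP, hPA, hP, smul_smul, ha]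
  refine ⟨?_, ?_, hMX.trans hXM.symm⟩
  · rw [hMX]
    simp [sub_mul, mul_sub, hPA, hP]
  · rw [hXM]
    simp [sub_mul, mul_sub, hPB, hP]

/-- For a graph `G` on `n ≥ 1` vertices with Laplacian `L` and `a > 0`, the matrix
`L + a·I_n` is invertible, and with `M = L + a·I_n − (a/n)·J_n` and
`X = (L + a·I_n)⁻¹ − (1/(a·n))·J_n` one has `M·X·M = M`, `X·M·X = X` and `M·X = X·M`,
i.e. `X` is the group inverse of `M`. -/
theorem groupInverse_lap_shift (n : ℕ) (hn : 1 ≤ n) (G : SimpleGraph (Fin n))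
    (a : ℝ) (ha : 0 < a) :
    IsUnit (lapMat G + a • (1 : Matrix (Fin n) (Fin n) ℝ)) ∧
    ∀ M X : Matrix (Fin n) (Fin n) ℝ,
      M = lapMat G + a • (1 : Matrix (Fin n) (Fin n) ℝ) - (a / n) • allOnes n →
      X = (lapMat G + a • (1 : Matrix (Fin n) (Fin n) ℝ))⁻¹ - (1 / (a * n)) • allOnes n →
      M * X * M = M ∧ X * M * X = X ∧ M * X = X * M := by
  have hunit := isUnit_lapMat_add_smul_one G ha
  refine ⟨hunit, ?_⟩
  rintro M X rfl rfl
  have hn0 : (n : ℝ) ≠ 0 := Nat.cast_ne_zero.mpr (by omega)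
  have hdet := (Matrix.isUnit_iff_isUnit_det _).mp hunit
  have h₁ : (a / n) • allOnes n = a • ((n : ℝ)⁻¹ • allOnes n) := by
    rw [smul_smul, div_eq_mul_inv]
  have h₂ : (1 / (a * n)) • allOnes n = a⁻¹ • ((n : ℝ)⁻¹ • allOnes n) := by
    rw [smul_smul, one_div, mul_inv]
  rw [h₁, h₂]
  refine groupInverse_sub_smul_idempotent ha.ne' (Matrix.mul_nonsing_inv _ hdet)
    (Matrix.nonsing_inv_mul _ hdet) ?_ ?_ ?_
  · simp [add_mul, lapMat_mul_allOnes, smul_comm a]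
  · simp [mul_add, allOnes_mul_lapMat, smul_comm a]
  · simp [allOnes_mul_allOnes, smul_smul, hn0]
end

section
/- Let k ≥ 2 and p₁, p₂ ≥ k, let G = K_{p₁} ∘_k K_{p₂}, t = p₁ + p₂ − k, and let L be the Laplacian matrix of G. Then for any two distinct vertices i, j ∈ T (the identified clique) and every matrix X with L·X·L = L, one has X_{ii} + X_{jj} − X_{ij} − X_{ji} = 2/t; that is, the resistance distance between any two identified vertices equals 2/t. -/
open Matrix BigOperators

/-- Vertex set of the `k`-coalescence `K_{p₁} ∘ₖ K_{p₂}`: the identified clique `T`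
(of size `k`), the remaining vertices `A` of `K_{p₁}` (size `a = p₁ − k`) and the
remaining vertices `B` of `K_{p₂}` (size `b = p₂ − k`). -/
abbrev CoalV (k a b : ℕ) := Fin k ⊕ (Fin a ⊕ Fin b)

/-- `u` lies in the part `A`. -/
def memA {k a b : ℕ} : CoalV k a b → Prop
  | Sum.inr (Sum.inl _) => True
  | _ => False

/-- `u` lies in the part `B`. -/
def memB {k a b : ℕ} : CoalV k a b → Prop
  | Sum.inr (Sum.inr _) => True
  | _ => False

/-- The `k`-coalescence `K_{p₁} ∘ₖ K_{p₂}` (with `a = p₁ − k`, `b = p₂ − k`):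
two distinct vertices are adjacent iff they do not lie one in `A` and one in `B`. -/
def KCoal (k a b : ℕ) : SimpleGraph (CoalV k a b) :=
  SimpleGraph.fromRel (fun u v => ¬((memA u ∧ memB v) ∨ (memB u ∧ memA v)))

open Classical in
lemma lapMat_apply_of_dominating {V : Type} [Fintype V] (G : SimpleGraph V) {i : V}
    (hi : ∀ v, v ≠ i → G.Adj i v) (v : V) :
    lapMat G i v = (if v = i then (Fintype.card V : ℝ) else 0) - 1 := by
  by_cases h : v = i
  · subst h
    have hs : {w // G.Adj v w} ≃ {w // w ≠ v} :=
      Equiv.subtypeEquivRight fun w => ⟨fun h => h.ne', hi w⟩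
    have hpos : 1 ≤ Fintype.card V := Fintype.card_pos_iff.mpr ⟨v⟩
    have hc : Nat.card {w // G.Adj v w} = Fintype.card V - 1 := by
      rw [Nat.card_congr hs, Nat.card_eq_fintype_card, Fintype.card_subtype_compl,
        Fintype.card_subtype_eq]
    simp only [lapMat, of_apply, if_true, hc, Nat.cast_sub hpos, Nat.cast_one]
  · simp [lapMat, h, Ne.symm h, hi v h]

lemma lapMat_symm {V : Type} [Fintype V] (G : SimpleGraph V) (u v : V) :
    lapMat G u v = lapMat G v u := by
  by_cases h : u = v
  · rw [h]
  · by_cases ha : G.Adj u v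
    · simp [lapMat, h, Ne.symm h, ha, ha.symm]
    · simp [lapMat, h, Ne.symm h, ha, mt SimpleGraph.Adj.symm ha]

/-- The resistance distance between two distinct dominating vertices of a graph on `n` vertices
is `2 / n`. -/
lemma resistance_of_dominating {V : Type} [Fintype V] (G : SimpleGraph V) {i j : V} (hij : i ≠ j)
    (hi : ∀ v, v ≠ i → G.Adj i v) (hj : ∀ v, v ≠ j → G.Adj j v) (X : Matrix V V ℝ)
    (hX : lapMat G * X * lapMat G = lapMat G) :
    X i i + X j j - X i j - X j i = 2 / (Fintype.card V : ℝ) := by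
  classical
  set n : ℝ := (Fintype.card V : ℝ)
  have hn0 : n ≠ 0 := Nat.cast_ne_zero.mpr (Fintype.card_pos_iff.mpr ⟨i⟩).ne'
  set x : V → ℝ := Pi.single i 1 - Pi.single j 1 with hx
  have hxL : x ᵥ* lapMat G = n • x := by
    ext v
    simp only [hx, sub_vecMul, single_one_vecMul, Pi.sub_apply, Pi.smul_apply, smul_eq_mul,
      row_apply, lapMat_apply_of_dominating G hi, lapMat_apply_of_dominating G hj, Pi.single_apply]
    split_ifs <;> ring
  have hLx : lapMat G *ᵥ x = n • x := by
    rw [← hxL, ← vecMul_transpose]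
    congr 1
    ext u v
    exact lapMat_symm G v u
  have hquad (M : Matrix V V ℝ) : x ⬝ᵥ (M *ᵥ x) = M i i + M j j - M i j - M j i := by
    simp [hx, mulVec_sub, sub_dotProduct]
    ring
  have hxx : x ⬝ᵥ x = 2 := by
    simp [hx, hij, hij.symm]
    norm_num
  have key : n * (n * (x ⬝ᵥ (X *ᵥ x))) = n * 2 := by
    calc n * (n * (x ⬝ᵥ (X *ᵥ x))) = x ⬝ᵥ ((lapMat G * X * lapMat G) *ᵥ x) := by
          rw [← mulVec_mulVec, hLx, ← mulVec_mulVec, dotProduct_mulVec x (lapMat G), hxL]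
          simp [mulVec_smul]
      _ = n * 2 := by rw [hX, hLx, dotProduct_smul, hxx, smul_eq_mul]
  rw [← hquad, eq_div_iff hn0, mul_comm]
  exact mul_left_cancel₀ hn0 key

lemma KCoal_adj_inl {k a b : ℕ} (i : Fin k) (v : CoalV k a b) (hv : v ≠ Sum.inl i) :
    (KCoal k a b).Adj (Sum.inl i) v := by
  simp [KCoal, SimpleGraph.fromRel_adj, memA, memB, hv.symm]

/-- In `K_{p₁} ∘ₖ K_{p₂}` with `k ≥ 2`, `p₁, p₂ ≥ k` and `t = p₁ + p₂ − k`, the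
resistance distance between any two distinct identified vertices equals `2/t`. -/
theorem resistance_coal_TT (k p₁ p₂ : ℕ) (hk : 2 ≤ k) (h1 : k ≤ p₁) (h2 : k ≤ p₂)
    (i j : Fin k) (hij : i ≠ j)
    (X : Matrix (CoalV k (p₁ - k) (p₂ - k)) (CoalV k (p₁ - k) (p₂ - k)) ℝ)
    (hX : lapMat (KCoal k (p₁ - k) (p₂ - k)) * X * lapMat (KCoal k (p₁ - k) (p₂ - k))
        = lapMat (KCoal k (p₁ - k) (p₂ - k))) :
    X (Sum.inl i) (Sum.inl i) + X (Sum.inl j) (Sum.inl j)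
      - X (Sum.inl i) (Sum.inl j) - X (Sum.inl j) (Sum.inl i)
      = 2 / ((p₁ : ℝ) + (p₂ : ℝ) - (k : ℝ)) := by
  rw [resistance_of_dominating _ (by simpa using hij) (KCoal_adj_inl i) (KCoal_adj_inl j) X hX]
  simp only [Fintype.card_sum, Fintype.card_fin, Nat.cast_add, Nat.cast_sub h1, Nat.cast_sub h2]
  congr 1
  ring
end

section
/- Let k ≥ 1 and p₁ ≥ k, p₂ > k, let G = K_{p₁} ∘_k K_{p₂}, t = p₁ + p₂ − k, and let L be the Laplacian matrix of G. Then for every vertex i ∈ T, every vertex j ∈ B, and every matrix X with L·X·L = L, one has X_{ii} + X_{jj} − X_{ij} − X_{ji} = ((k+1)(p₁ − k) + 2p₂k)/(k·p₂·t); that is, the resistance distance between an identified vertex and a non-identified vertex of K_{p₂} equals ((k+1)(p₁−k) + 2p₂k)/(k p₂ t). -/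
open Matrix BigOperators

open Classical in
/-- The Laplacian acts as a sum of differences over neighbours. -/
theorem lapMat_mulVec_apply {V : Type} [Fintype V] (G : SimpleGraph V) (y : V → ℝ) (v : V) :
    (lapMat G *ᵥ y) v = ∑ u, if G.Adj v u then y v - y u else 0 := by
  have hdeg : (Nat.card {u // G.Adj v u} : ℝ) = ∑ u, if G.Adj v u then (1 : ℝ) else 0 := by
    rw [Nat.card_eq_fintype_card, Fintype.card_subtype, Finset.sum_boole]
  have hentry : ∀ u, lapMat G v u * y u
      = (if v = u then (Nat.card {u // G.Adj v u} : ℝ) * y v else 0)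
        - (if G.Adj v u then y u else 0) := by
    intro u
    by_cases h : v = u
    · subst h
      simp [lapMat]
    · by_cases hadj : G.Adj v u <;> simp [lapMat, h, hadj]
  simp only [Matrix.mulVec, dotProduct, hentry]
  rw [Finset.sum_sub_distrib, Finset.sum_ite_eq, if_pos (Finset.mem_univ v), hdeg,
    Finset.sum_mul, ← Finset.sum_sub_distrib]
  refine Finset.sum_congr rfl fun u _ => ?_
  split_ifs <;> ring

theorem lapMat_isSymm {V : Type} [Fintype V] (G : SimpleGraph V) : (lapMat G).IsSymm := by
  ext i j
  by_cases h : i = j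
  · subst h
    rfl
  · by_cases hadj : G.Adj i j
    · simp [lapMat, h, Ne.symm h, hadj, hadj.symm]
    · simp [lapMat, h, Ne.symm h, hadj, mt SimpleGraph.Adj.symm hadj]

/-- If `L y = w`, then `wᵀ X w = yᵀ w` for every `{1}`-inverse `X` of the symmetric matrix `L`. -/
theorem dotProduct_mulVec_of_oneInverse {V : Type} [Fintype V] {L X : Matrix V V ℝ}
    (hL : L.IsSymm) (hX : L * X * L = L) {y w : V → ℝ} (hy : L *ᵥ y = w) :
    w ⬝ᵥ X *ᵥ w = y ⬝ᵥ w := by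
  have hw : w = y ᵥ* L := by rw [← Matrix.mulVec_transpose, hL.eq, hy]
  calc w ⬝ᵥ X *ᵥ w = (y ᵥ* L) ⬝ᵥ X *ᵥ (L *ᵥ y) := by rw [← hw, hy]
    _ = y ⬝ᵥ (L * X * L) *ᵥ y := by
      rw [← Matrix.dotProduct_mulVec, Matrix.mulVec_mulVec, Matrix.mulVec_mulVec, Matrix.mul_assoc]
    _ = y ⬝ᵥ w := by rw [hX, hy]

section Coalescence

variable {k a b : ℕ} (y : CoalV k a b → ℝ)

theorem lapMat_KCoal_mulVec_inl (i : Fin k) :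
    (lapMat (KCoal k a b) *ᵥ y) (Sum.inl i) = ∑ u, (y (Sum.inl i) - y u) := by
  classical
  rw [lapMat_mulVec_apply]
  refine Finset.sum_congr rfl fun u _ => ?_
  by_cases h : Sum.inl i = u
  · simp [← h]
  · simp [KCoal, SimpleGraph.fromRel_adj, memA, memB, h]

theorem lapMat_KCoal_mulVec_inr_inl (i : Fin a) :
    (lapMat (KCoal k a b) *ᵥ y) (Sum.inr (Sum.inl i))
      = ∑ u, (y (Sum.inr (Sum.inl i)) - y (Sum.inl u))
        + ∑ u, (y (Sum.inr (Sum.inl i)) - y (Sum.inr (Sum.inl u))) := by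
  classical
  rw [lapMat_mulVec_apply, Fintype.sum_sum_type, Fintype.sum_sum_type]
  simp only [KCoal, SimpleGraph.fromRel_adj, memA, memB]
  have h : ∀ u : Fin a, (if i = u then 0 else y (Sum.inr (Sum.inl i)) - y (Sum.inr (Sum.inl u)))
      = y (Sum.inr (Sum.inl i)) - y (Sum.inr (Sum.inl u)) := by
    intro u
    split_ifs with hu
    · simp [hu]
    · rfl
  simp [h, -Finset.sum_sub_distrib]

theorem lapMat_KCoal_mulVec_inr_inr (j : Fin b) :
    (lapMat (KCoal k a b) *ᵥ y) (Sum.inr (Sum.inr j))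
      = ∑ u, (y (Sum.inr (Sum.inr j)) - y (Sum.inl u))
        + ∑ u, (y (Sum.inr (Sum.inr j)) - y (Sum.inr (Sum.inr u))) := by
  classical
  rw [lapMat_mulVec_apply, Fintype.sum_sum_type, Fintype.sum_sum_type]
  simp only [KCoal, SimpleGraph.fromRel_adj, memA, memB]
  have h : ∀ u : Fin b, (if j = u then 0 else y (Sum.inr (Sum.inr j)) - y (Sum.inr (Sum.inr u)))
      = y (Sum.inr (Sum.inr j)) - y (Sum.inr (Sum.inr u)) := by
    intro u
    split_ifs with hu
    · simp [hu]
    · rfl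
  simp [h, -Finset.sum_sub_distrib]

end Coalescence

/-- The potential on `K_{k+a} ∘ₖ K_{k+b}` of the unit current from `i ∈ T` to `j ∈ B`. -/
noncomputable def coalPotential {k a b : ℕ} (i : Fin k) (j : Fin b) : CoalV k a b → ℝ :=
  Sum.elim (fun u => if u = i then 1 / ((k : ℝ) + a + b) else 0)
    (Sum.elim (fun _ => 1 / ((k : ℝ) * (k + a + b)))
      (fun u => -(a : ℝ) / (k * (k + a + b) * (k + b)) - if u = j then 1 / ((k : ℝ) + b) else 0))

theorem lapMat_KCoal_mulVec_coalPotential {k a b : ℕ} (hk : 1 ≤ k) (i : Fin k) (j : Fin b) :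
    lapMat (KCoal k a b) *ᵥ coalPotential i j
      = Pi.single (Sum.inl i) 1 - Pi.single (Sum.inr (Sum.inr j)) 1 := by
  have hk0 : (0 : ℝ) < k := by exact_mod_cast hk
  have ht : (k : ℝ) + a + b ≠ 0 := by positivity
  have hb : (k : ℝ) + b ≠ 0 := by positivity
  ext v
  rcases v with v | v | v
  · rw [lapMat_KCoal_mulVec_inl]
    by_cases h : v = i <;>
      simp [coalPotential, Fintype.sum_sum_type, h] <;> field_simp <;> ring
  · rw [lapMat_KCoal_mulVec_inr_inl]
    simp [coalPotential]
    field_simp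
    ring
  · rw [lapMat_KCoal_mulVec_inr_inr]
    by_cases h : v = j <;>
      simp [coalPotential, h] <;> field_simp <;> ring

/-- In `K_{p₁} ∘ₖ K_{p₂}` with `k ≥ 1`, `p₁ ≥ k`, `p₂ > k` and `t = p₁ + p₂ − k`, the
resistance distance between an identified vertex and a non-identified vertex of
`K_{p₂}` equals `((k+1)(p₁−k) + 2p₂k)/(k·p₂·t)`. -/
theorem resistance_coal_TB (k p₁ p₂ : ℕ) (hk : 1 ≤ k) (h1 : k ≤ p₁) (h2 : k < p₂)
    (i : Fin k) (j : Fin (p₂ - k))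
    (X : Matrix (CoalV k (p₁ - k) (p₂ - k)) (CoalV k (p₁ - k) (p₂ - k)) ℝ)
    (hX : lapMat (KCoal k (p₁ - k) (p₂ - k)) * X * lapMat (KCoal k (p₁ - k) (p₂ - k))
        = lapMat (KCoal k (p₁ - k) (p₂ - k))) :
    X (Sum.inl i) (Sum.inl i) + X (Sum.inr (Sum.inr j)) (Sum.inr (Sum.inr j))
      - X (Sum.inl i) (Sum.inr (Sum.inr j)) - X (Sum.inr (Sum.inr j)) (Sum.inl i)
      = (((k : ℝ) + 1) * ((p₁ : ℝ) - (k : ℝ)) + 2 * (p₂ : ℝ) * (k : ℝ))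
          / ((k : ℝ) * (p₂ : ℝ) * ((p₁ : ℝ) + (p₂ : ℝ) - (k : ℝ))) := by
  have hk0 : (0 : ℝ) < k := by exact_mod_cast hk
  have hp : (0 : ℝ) < p₂ := by exact_mod_cast (by omega : 0 < p₂)
  have h1' : (k : ℝ) ≤ p₁ := by exact_mod_cast h1
  have ht : (p₁ : ℝ) + (p₂ - k) ≠ 0 := by linarith
  have key := dotProduct_mulVec_of_oneInverse (lapMat_isSymm _) hX
    (lapMat_KCoal_mulVec_coalPotential hk i j)
  have e2 : (k : ℝ) + (p₂ - k) = p₂ := by ring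
  simp [sub_dotProduct, dotProduct_sub, Matrix.mulVec_sub, coalPotential, Nat.cast_sub h1,
    Nat.cast_sub h2.le, e2] at key
  trans
  · refine Eq.trans ?_ key
    ring
  · rw [add_sub_assoc]
    field_simp
    ring
end

section
/- Let n > 1 and t ≥ 2, let G = W_{n+1}^t be the windmill graph, and let L be its Laplacian matrix. Then for any two distinct vertices i, j of G and every matrix X with L·X·L = L, one has X_{ii} + X_{jj} − X_{ij} − X_{ji} = 4/(n+1) if i and j are non-central vertices lying in different copies of K_{n+1}, and X_{ii} + X_{jj} − X_{ij} − X_{ji} = 2/(n+1) otherwise (i.e., if i and j lie in the same copy of K_{n+1}, including the case where one of them is the central vertex). -/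
open Matrix BigOperators

/-- Vertex set of the windmill graph `W_{n+1}^t`: a central vertex together with
`t` copies of `n` further vertices. -/
abbrev WindV (n t : ℕ) := Unit ⊕ (Fin t × Fin n)

/-- The windmill graph `W_{n+1}^t`: `t` copies of `K_{n+1}` sharing one common
central vertex. The center is adjacent to every other vertex, and two non-central
vertices are adjacent iff they are distinct and lie in the same copy. -/
def Windmill (n t : ℕ) : SimpleGraph (WindV n t) :=
  SimpleGraph.fromRel (fun u v =>
    u = Sum.inl () ∨ v = Sum.inl () ∨
      ∃ (c : Fin t) (a b : Fin n), u = Sum.inr (c, a) ∧ v = Sum.inr (c, b))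

/-- If `L` is symmetric and `L u = e_i - e_j`, then every `{1}`-inverse `X` of `L` satisfies
`X i i + X j j - X i j - X j i = u i - u j`. -/
theorem resistance_eq_potential_sub {V : Type} [Fintype V] [DecidableEq V]
    {L X : Matrix V V ℝ} (hL : L.IsSymm) (hX : L * X * L = L) {u : V → ℝ} {i j : V}
    (hu : L *ᵥ u = Pi.single i 1 - Pi.single j 1) :
    X i i + X j j - X i j - X j i = u i - u j := by
  have hu' : u ᵥ* L = Pi.single i 1 - Pi.single j 1 := by
    rw [← mulVec_transpose, hL.eq, hu]
  have h : u ⬝ᵥ ((L * X * L) *ᵥ u) = u ⬝ᵥ (L *ᵥ u) := by rw [hX]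
  rw [← mulVec_mulVec, hu, ← mulVec_mulVec, dotProduct_mulVec, hu'] at h
  simp only [mulVec_sub, sub_dotProduct, dotProduct_sub, mulVec_single_one, single_dotProduct,
    dotProduct_single, col_apply, one_mul, mul_one] at h
  linarith

theorem windmill_adj_inr_inr {n t : ℕ} (p q : Fin t × Fin n) :
    (Windmill n t).Adj (Sum.inr p) (Sum.inr q) ↔ p ≠ q ∧ p.1 = q.1 := by
  obtain ⟨i, a⟩ := p
  obtain ⟨j, b⟩ := q
  simp only [Windmill, SimpleGraph.fromRel_adj]
  aesop

theorem windmill_adj_inl_inr {n t : ℕ} (p : Fin t × Fin n) :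
    (Windmill n t).Adj (Sum.inl ()) (Sum.inr p) := by
  simp [Windmill]

theorem windmill_card_neighbors_inr {n t : ℕ} (p : Fin t × Fin n) :
    Nat.card {v // (Windmill n t).Adj (Sum.inr p) v} = n := by
  classical
  obtain ⟨i, a⟩ := p
  let e : Option {b : Fin n // b ≠ a} ≃ {v // (Windmill n t).Adj (Sum.inr (i, a)) v} :=
    Equiv.ofBijective
      (fun o => o.elim ⟨Sum.inl (), (windmill_adj_inl_inr _).symm⟩
        fun b => ⟨Sum.inr (i, b), by simp [windmill_adj_inr_inr, b.2.symm]⟩) (by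
      constructor
      · rintro (_ | ⟨b, hb⟩) (_ | ⟨c, hc⟩) h <;> simp_all
      · rintro ⟨⟨⟩ | ⟨j, b⟩, h⟩
        · exact ⟨none, rfl⟩
        · obtain ⟨hne, rfl : i = j⟩ := (windmill_adj_inr_inr _ _).1 h
          exact ⟨some ⟨b, by rintro rfl; exact hne rfl⟩, rfl⟩)
  rw [← Nat.card_congr e]
  have := a.pos
  simp
  omega

/-- The potential, grounded at the center, of a unit current entering the windmill graph at the
non-central vertex `p` and leaving at the center. -/
noncomputable def windmillPotential (n t : ℕ) (p : Fin t × Fin n) : WindV n t → ℝ :=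
  Sum.elim 0 fun q =>
    if q.1 = p.1 then ((if q.2 = p.2 then 1 else 0) + 1) / ((n : ℝ) + 1) else 0

theorem lapMat_windmill_mulVec_potential {n t : ℕ} (p : Fin t × Fin n) :
    lapMat (Windmill n t) *ᵥ windmillPotential n t p =
      Pi.single (Sum.inr p) 1 - Pi.single (Sum.inl ()) 1 := by
  have hn : (n : ℝ) + 1 ≠ 0 := by positivity
  have hsum (i : Fin t) : ∑ b, windmillPotential n t p (Sum.inr (i, b)) =
      if i = p.1 then 1 else 0 := by
    by_cases h : i = p.1
    · simp [windmillPotential, h, ← Finset.sum_div, Finset.sum_add_distrib]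
      field_simp
      ring
    · simp [windmillPotential, h]
  have hinl : windmillPotential n t p (Sum.inl ()) = 0 := rfl
  ext (_ | ⟨j, b⟩)
  · have hrow (q : Fin t × Fin n) :
        lapMat (Windmill n t) (Sum.inl ()) (Sum.inr q) = -1 := by
      simp [lapMat, windmill_adj_inl_inr]
    simp [mulVec, dotProduct, hrow, hinl, Fintype.sum_prod_type, hsum]
  · have hrow (k : Fin t) (c : Fin n) :
        lapMat (Windmill n t) (Sum.inr (j, b)) (Sum.inr (k, c)) =
          if j = k then (if b = c then (n : ℝ) + 1 else 0) - 1 else 0 := by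
      simp only [lapMat, of_apply, windmill_card_neighbors_inr, windmill_adj_inr_inr]
      by_cases hj : j = k <;> by_cases hb : b = c <;> simp [hj, hb]
    have hval : (lapMat (Windmill n t) *ᵥ windmillPotential n t p) (Sum.inr (j, b)) =
        ((n : ℝ) + 1) * windmillPotential n t p (Sum.inr (j, b)) -
          ∑ c, windmillPotential n t p (Sum.inr (j, c)) := by
      simp only [mulVec, dotProduct, Fintype.sum_sum_type, Fintype.sum_prod_type, hrow, hinl]
      simp [Finset.sum_ite_irrel, sub_mul]
    rw [hval, hsum]
    obtain ⟨i, a⟩ := p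
    by_cases hj : j = i <;> by_cases hb : b = a <;>
      simp [windmillPotential, hj, hb, hn, mul_div_cancel₀]

/-- Resistance distances in the windmill graph `W_{n+1}^t` (`n > 1`, `t ≥ 2`):
`4/(n+1)` between non-central vertices in different copies of `K_{n+1}`, and
`2/(n+1)` between any two distinct vertices in the same copy (including pairs
involving the central vertex). -/
theorem resistance_windmill (n t : ℕ) (hn : 1 < n) (ht : 2 ≤ t)
    (X : Matrix (WindV n t) (WindV n t) ℝ)
    (hX : lapMat (Windmill n t) * X * lapMat (Windmill n t) = lapMat (Windmill n t)) :
    (∀ (i j : Fin t) (a b : Fin n), i ≠ j →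
      X (Sum.inr (i, a)) (Sum.inr (i, a)) + X (Sum.inr (j, b)) (Sum.inr (j, b))
        - X (Sum.inr (i, a)) (Sum.inr (j, b)) - X (Sum.inr (j, b)) (Sum.inr (i, a))
        = 4 / ((n : ℝ) + 1)) ∧
    (∀ (i : Fin t) (a b : Fin n), a ≠ b →
      X (Sum.inr (i, a)) (Sum.inr (i, a)) + X (Sum.inr (i, b)) (Sum.inr (i, b))
        - X (Sum.inr (i, a)) (Sum.inr (i, b)) - X (Sum.inr (i, b)) (Sum.inr (i, a))
        = 2 / ((n : ℝ) + 1)) ∧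
    (∀ (i : Fin t) (a : Fin n),
      X (Sum.inl ()) (Sum.inl ()) + X (Sum.inr (i, a)) (Sum.inr (i, a))
        - X (Sum.inl ()) (Sum.inr (i, a)) - X (Sum.inr (i, a)) (Sum.inl ())
        = 2 / ((n : ℝ) + 1)) := by
  have hL := lapMat_isSymm (Windmill n t)
  have hpair (p q : Fin t × Fin n) := resistance_eq_potential_sub hL hX
    (u := windmillPotential n t p - windmillPotential n t q) (i := Sum.inr p) (j := Sum.inr q) (by
      simp [mulVec_sub, lapMat_windmill_mulVec_potential])
  refine ⟨fun i j a b hij => ?_, fun i a b hab => ?_, fun i a => ?_⟩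
  · rw [hpair]
    simp [windmillPotential, hij, hij.symm]
    ring
  · rw [hpair]
    simp [windmillPotential, hab, hab.symm]
    ring
  · have h := resistance_eq_potential_sub hL hX (lapMat_windmill_mulVec_potential (i, a))
    norm_num [windmillPotential] at h
    linarith
end

section
/- Let n > 1 and t ≥ 2. The Kemeny's constant of the windmill graph W_{n+1}^t equals κ(W_{n+1}^t) = n²(2t − 1)/(n+1). -/
open Matrix BigOperators

-- The degree of a vertex, as a real number.
noncomputable def degR {V : Type} [Fintype V] (G : SimpleGraph V) (i : V) : ℝ :=
  (Nat.card {v // G.Adj i v} : ℝ)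

lemma resistance_eq_of_mulVec_eq {V : Type} [Fintype V] [DecidableEq V] {L X : Matrix V V ℝ}
    (hL : L.IsSymm) (hX : L * X * L = L) {i j : V} {y : V → ℝ}
    (hy : L *ᵥ y = Pi.single i 1 - Pi.single j 1) :
    X i i + X j j - X i j - X j i = y i - y j := by
  have h : (L *ᵥ y) ⬝ᵥ (X *ᵥ (L *ᵥ y)) = y ⬝ᵥ (L *ᵥ y) := by
    have hy' : y ᵥ* L = L *ᵥ y := by rw [← mulVec_transpose, hL.eq]
    conv_rhs => rw [← hX, Matrix.mul_assoc, ← mulVec_mulVec, ← mulVec_mulVec, dotProduct_mulVec, hy']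
  rw [hy] at h
  simp only [mulVec_sub, mulVec_single_one, sub_dotProduct, dotProduct_sub, single_dotProduct,
    dotProduct_single, Matrix.col_apply, one_mul, mul_one] at h
  linarith

lemma natCard_subtype_eq_sum {V : Type} [Fintype V] (p : V → Prop) [DecidablePred p] :
    (Nat.card {v // p v} : ℝ) = ∑ v, if p v then 1 else 0 := by
  simp [Nat.card_eq_fintype_card, Fintype.card_subtype]

namespace Windmill

variable {n t : ℕ}

@[simp] lemma adj_inl_inl {u v : Unit} : ¬ (Windmill n t).Adj (Sum.inl u) (Sum.inl v) := by
  simp [Windmill]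

@[simp] lemma adj_inl_inr {u : Unit} {p : Fin t × Fin n} :
    (Windmill n t).Adj (Sum.inl u) (Sum.inr p) := by
  simp [Windmill]

@[simp] lemma adj_inr_inl {u : Unit} {p : Fin t × Fin n} :
    (Windmill n t).Adj (Sum.inr p) (Sum.inl u) := by
  simp [Windmill]

@[simp] lemma adj_inr_inr {c d : Fin t} {a b : Fin n} :
    (Windmill n t).Adj (Sum.inr (c, a)) (Sum.inr (d, b)) ↔ c = d ∧ a ≠ b := by
  simp only [Windmill, SimpleGraph.fromRel_adj]
  grind

lemma degR_inl (u : Unit) : degR (Windmill n t) (Sum.inl u) = t * n := by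
  classical
  rw [degR, natCard_subtype_eq_sum, Fintype.sum_sum_type]
  simp

lemma degR_inr (p : Fin t × Fin n) : degR (Windmill n t) (Sum.inr p) = n := by
  classical
  obtain ⟨c, a⟩ := p
  have h (d : Fin t) (b : Fin n) : (if c = d ∧ a ≠ b then (1 : ℝ) else 0) =
      (if c = d then 1 else 0) * (1 - if a = b then 1 else 0) := by
    split_ifs <;> simp_all
  rw [degR, natCard_subtype_eq_sum]
  simp only [Fintype.sum_sum_type, Fintype.sum_prod_type, adj_inr_inl, adj_inr_inr, h,
    ← Finset.mul_sum, ← Finset.sum_mul]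
  simp

lemma lapMat_inl_inl (u v : Unit) :
    lapMat (Windmill n t) (Sum.inl u) (Sum.inl v) = t * n := by
  simpa [lapMat, degR] using degR_inl (n := n) (t := t) u

lemma lapMat_inl_inr (u : Unit) (p : Fin t × Fin n) :
    lapMat (Windmill n t) (Sum.inl u) (Sum.inr p) = -1 := by
  simp [lapMat]

lemma lapMat_inr_inl (p : Fin t × Fin n) (u : Unit) :
    lapMat (Windmill n t) (Sum.inr p) (Sum.inl u) = -1 := by
  simp [lapMat]

lemma lapMat_inr_inr (c d : Fin t) (a b : Fin n) :
    lapMat (Windmill n t) (Sum.inr (c, a)) (Sum.inr (d, b)) =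
      (if c = d then 1 else 0) * ((n + 1) * (if a = b then 1 else 0) - 1) := by
  have h := degR_inr (c, a)
  rw [degR] at h
  simp only [lapMat, of_apply, h, adj_inr_inr, Sum.inr.injEq, Prod.mk.injEq]
  split_ifs <;> simp_all

lemma isSymm_lapMat : (lapMat (Windmill n t)).IsSymm := by
  ext (u | ⟨c, a⟩) (v | ⟨d, b⟩)
  · simp [lapMat_inl_inl]
  · simp [lapMat_inl_inr, lapMat_inr_inl]
  · simp [lapMat_inl_inr, lapMat_inr_inl]
  · simp [lapMat_inr_inr, eq_comm]

/-- The potential at each vertex when a unit current enters at the given vertex and leaves at the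
grounded center. -/
noncomputable def potential : WindV n t → WindV n t → ℝ
  | Sum.inr (c, a), Sum.inr (d, b) =>
    (if c = d then 1 else 0) * ((if a = b then 1 else 0) + 1) / (n + 1)
  | _, _ => 0

lemma lapMat_mulVec_potential (v : WindV n t) :
    lapMat (Windmill n t) *ᵥ potential v = Pi.single v 1 - Pi.single (Sum.inl ()) 1 := by
  have hn : (n : ℝ) + 1 ≠ 0 := by positivity
  obtain u | ⟨c, a⟩ := v
  · ext w
    simp [potential, mulVec, dotProduct]
  · ext (u | ⟨d, b⟩)
    · simp only [potential, mulVec, dotProduct, Fintype.sum_sum_type, Fintype.sum_prod_type,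
        lapMat_inl_inr, ← Finset.sum_div, ← Finset.mul_sum, ← Finset.sum_mul]
      simp [Finset.sum_add_distrib]
      field_simp
      ring
    · have h (x : Fin n) : ((n + 1) * (if b = x then (1 : ℝ) else 0) - 1) *
          ((if a = x then 1 else 0) + 1) = (n + 1) * (if b = x then (if a = x then 1 else 0) else 0)
            + (n + 1) * (if b = x then 1 else 0) - (if a = x then 1 else 0) - 1 := by
        split_ifs <;> ring
      have h' (e : Fin t) (x : Fin n) : (if d = e then (1 : ℝ) else 0) *
          ((n + 1) * (if b = x then 1 else 0) - 1) *
          ((if c = e then 1 else 0) * ((if a = x then 1 else 0) + 1) / (n + 1)) =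
          (if d = e then (if c = e then 1 else 0) else 0) *
            (((n + 1) * (if b = x then (1 : ℝ) else 0) - 1) *
              ((if a = x then 1 else 0) + 1)) / (n + 1) := by
        split_ifs <;> ring
      simp only [potential, mulVec, dotProduct, Fintype.sum_sum_type, Fintype.sum_prod_type,
        lapMat_inr_inr, lapMat_inr_inl, h', h, ← Finset.sum_div, ← Finset.mul_sum,
        ← Finset.sum_mul, Finset.sum_add_distrib, Finset.sum_sub_distrib]
      simp only [Finset.sum_ite_eq, Finset.mem_univ]
      by_cases hcd : c = d <;> by_cases hab : a = b <;> simp [hcd, hab, eq_comm]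
      field_simp
      ring

lemma resistance_eq {X : Matrix (WindV n t) (WindV n t) ℝ}
    (hX : lapMat (Windmill n t) * X * lapMat (Windmill n t) = lapMat (Windmill n t))
    (i j : WindV n t) :
    X i i + X j j - X i j - X j i =
      potential i i + potential j j - potential i j - potential j i := by
  rw [resistance_eq_of_mulVec_eq (y := potential i - potential j) isSymm_lapMat hX]
  · simp only [Pi.sub_apply]
    ring
  · rw [mulVec_sub, lapMat_mulVec_potential, lapMat_mulVec_potential, sub_sub_sub_cancel_right]

lemma two_mul_card_edgeSet :
    2 * (Nat.card (Windmill n t).edgeSet : ℝ) = t * n * (n + 1) := by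
  classical
  have h := (Windmill n t).sum_degrees_eq_twice_card_edges
  have hd (v : WindV n t) : ((Windmill n t).degree v : ℝ) = degR (Windmill n t) v := by
    rw [degR, ← SimpleGraph.card_neighborSet_eq_degree, ← Nat.card_eq_fintype_card]
    rfl
  rw [Nat.card_eq_fintype_card, ← SimpleGraph.edgeFinset_card]
  have h' : ∑ v, ((Windmill n t).degree v : ℝ) = 2 * ((Windmill n t).edgeFinset.card : ℝ) := by
    exact_mod_cast h
  rw [← h']
  simp only [hd, Fintype.sum_sum_type, degR_inl, degR_inr]
  simp
  ring

end Windmill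

/-- Kemeny's constant `κ = (1/(4m))·Σ_{i,j} dᵢ·dⱼ·r(i,j)` of the windmill graph
`W_{n+1}^t` (`n > 1`, `t ≥ 2`, `m` the number of edges) equals `n²(2t−1)/(n+1)`. -/
theorem kemeny_windmill (n t : ℕ) (hn : 1 < n) (ht : 2 ≤ t)
    (X : Matrix (WindV n t) (WindV n t) ℝ)
    (hX : lapMat (Windmill n t) * X * lapMat (Windmill n t) = lapMat (Windmill n t)) :
    (1 / (4 * (Nat.card (Windmill n t).edgeSet : ℝ))) *
        ∑ i : WindV n t, ∑ j : WindV n t,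
          degR (Windmill n t) i * degR (Windmill n t) j * (X i i + X j j - X i j - X j i)
      = (n : ℝ)^2 * (2 * (t : ℝ) - 1) / ((n : ℝ) + 1) := by
  have hn' : (n : ℝ) ≠ 0 := by positivity
  have ht' : (t : ℝ) ≠ 0 := by positivity
  have hn1 : (n : ℝ) + 1 ≠ 0 := by positivity
  have hm : 4 * (Nat.card (Windmill n t).edgeSet : ℝ) = 2 * (t * n * (n + 1)) := by
    rw [← Windmill.two_mul_card_edgeSet]
    ring
  simp only [Windmill.resistance_eq hX, hm, Fintype.sum_sum_type, Fintype.sum_prod_type,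
    Windmill.degR_inl, Windmill.degR_inr, Windmill.potential, ← Finset.mul_sum, ← Finset.sum_div,
    Finset.sum_add_distrib, Finset.sum_sub_distrib]
  simp [← Finset.sum_mul, -mul_ite, -ite_mul]
  field_simp
  ring
end
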